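/- arXiv:0711.3859 — 4 statements merged into one kernel-verified Lean document; each statement's English description precedes it below -/
import Mathlib

section
/- Let N be a positive integer, Λ ∈ GL(N,ℝ), and let G be a smooth harmonic-Einstein map from ℝ to the symmetric positive-definite real N×N matrices such that G and G' both satisfy the Λ-holonomy boundary condition. Set s = (1/2)‖G'(0)‖²_{G(0)} and assume s > 0. Let λ > 0 and let C ≥ s/λ. Let M be a real N×N matrix with MΛ = ΛM such that G(ξ)M is symmetric for every ξ. Let h⊥ be a smooth map from ℝ to the symmetric real N×N matrices such that h⊥ and h⊥' both satisfy the Λ-holonomy boundary condition and such that ∫₀¹ ⟨(L₂h⊥)(ξ), h⊥(ξ)⟩_{G(ξ)} dξ ≤ −λ ∫₀¹ ‖h⊥(ξ)‖²_{G(ξ)} dξ. Set h(ξ) = G(ξ)M + h⊥(ξ). Let v : ℝ → ℝ and B : ℝ → ℝ^N be smooth with v(0) = v(1), v'(0) = v'(1), B(0) = B(1), and B'(0) = B'(1). Then ∫₀¹ [ (C v''(ξ) − s v(ξ) + (F h)(ξ)) v(ξ) + (B''(ξ) − (s/2)B(ξ)) · B(ξ) + ⟨(L₂h)(ξ), h(ξ)⟩_{G(ξ)}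 ] dξ ≤ −s ∫₀¹ v(ξ)² dξ − (s/2) ∫₀¹ |B(ξ)|² dξ − (λ/2) ∫₀¹ ‖h⊥(ξ)‖²_{G(ξ)} dξ. -/
open Matrix

/-- The fiberwise inner product `⟨φ,ψ⟩_G = tr(G⁻¹ φ G⁻¹ ψᵀ)`. -/
noncomputable def innerG {N : ℕ} (G φ ψ : Matrix (Fin N) (Fin N) ℝ) : ℝ :=
  (G⁻¹ * φ * G⁻¹ * ψᵀ).trace

/-- The Λ-holonomy boundary condition `φ(1) = Λᵀ φ(0) Λ`. -/
def holBC {N : ℕ} (Λ : Matrix (Fin N) (Fin N) ℝ)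
    (φ : ℝ → Matrix (Fin N) (Fin N) ℝ) : Prop :=
  φ 1 = Λᵀ * φ 0 * Λ

/-- The operator `L₂` associated to a fiber metric `G` (with derivative `G'`),
acting on `h` with derivatives `h'`, `h''`. -/
noncomputable def L2 {N : ℕ} (G G' h h' h'' : ℝ → Matrix (Fin N) (Fin N) ℝ)
    (ξ : ℝ) : Matrix (Fin N) (Fin N) ℝ :=
  h'' ξ - h' ξ * (G ξ)⁻¹ * G' ξ - G' ξ * (G ξ)⁻¹ * h' ξ
    + G' ξ * (G ξ)⁻¹ * h ξ * (G ξ)⁻¹ * G' ξ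

/-- The coupling term `(F h)(ξ) = ⟨G'(ξ), h'(ξ)⟩_{G(ξ)} − ⟨G''(ξ), h(ξ)⟩_{G(ξ)}`. -/
noncomputable def Fop {N : ℕ} (G G' G'' h h' : ℝ → Matrix (Fin N) (Fin N) ℝ)
    (ξ : ℝ) : ℝ :=
  innerG (G ξ) (G' ξ) (h' ξ) - innerG (G ξ) (G'' ξ) (h ξ)

section Positivity

open scoped MatrixOrder ComplexOrder Matrix.Norms.L2Operator

lemma innerG_self_nonneg {N : ℕ} {G : Matrix (Fin N) (Fin N) ℝ} (hG : G.PosDef)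
    (φ : Matrix (Fin N) (Fin N) ℝ) : 0 ≤ innerG G φ φ := by
  obtain ⟨S, hS⟩ := CStarAlgebra.nonneg_iff_eq_star_mul_self.mp hG.inv.posSemidef.nonneg
  have h := (hG.inv.posSemidef.mul_mul_conjTranspose_same (S * φ)).trace_nonneg
  have hSt : star S = Sᵀ := by simp [star_eq_conjTranspose]
  rw [conjTranspose_eq_transpose_of_trivial, transpose_mul] at h
  have e : G⁻¹ * φ * G⁻¹ * φᵀ = Sᵀ * (S * φ * G⁻¹ * φᵀ) := by
    conv_lhs => rw [hS, hSt]
    conv_rhs => rw [hS, hSt]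
    simp only [mul_assoc]
  rw [innerG, e, trace_mul_comm]
  simpa only [mul_assoc] using h

end Positivity

section MatrixCalculus

open scoped Matrix.Norms.Operator

lemma hasDerivAt_matrix {N : ℕ} {X : ℝ → Matrix (Fin N) (Fin N) ℝ}
    {X' : Matrix (Fin N) (Fin N) ℝ} {ξ : ℝ}
    (hX : ∀ i j, HasDerivAt (fun t => X t i j) (X' i j) ξ) : HasDerivAt X X' ξ :=
  hasDerivAt_pi.2 fun i => hasDerivAt_pi.2 fun j => hX i j

lemma HasDerivAt.matrix_apply {N : ℕ} {X : ℝ → Matrix (Fin N) (Fin N) ℝ}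
    {X' : Matrix (Fin N) (Fin N) ℝ} {ξ : ℝ} (hX : HasDerivAt X X' ξ) (i j : Fin N) :
    HasDerivAt (fun t => X t i j) (X' i j) ξ :=
  hasDerivAt_pi.1 (hasDerivAt_pi.1 hX i) j

lemma HasDerivAt.matrix_trace {N : ℕ} {X : ℝ → Matrix (Fin N) (Fin N) ℝ}
    {X' : Matrix (Fin N) (Fin N) ℝ} {ξ : ℝ} (hX : HasDerivAt X X' ξ) :
    HasDerivAt (fun t => (X t).trace) X'.trace ξ :=
  HasDerivAt.fun_sum fun i _ => hX.matrix_apply i i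

lemma HasDerivAt.matrix_inv {N : ℕ} {X : ℝ → Matrix (Fin N) (Fin N) ℝ}
    {X' : Matrix (Fin N) (Fin N) ℝ} {ξ : ℝ} (hX : HasDerivAt X X' ξ) (hu : IsUnit (X ξ)) :
    HasDerivAt (fun t => (X t)⁻¹) (-((X ξ)⁻¹ * X' * (X ξ)⁻¹)) ξ := by
  obtain ⟨u, hu⟩ := hu
  have h := hasFDerivAt_ringInverse (𝕜 := ℝ) u
  rw [hu] at h
  have h' := h.comp_hasDerivAt ξ hX
  have e : (↑u⁻¹ : Matrix (Fin N) (Fin N) ℝ) = (X ξ)⁻¹ := by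
    rw [← hu, Matrix.coe_units_inv]
  simp only [e] at h'
  refine h'.congr_of_eventuallyEq (Filter.Eventually.of_forall fun t => ?_)
  exact nonsing_inv_eq_ringInverse _

lemma hasDerivAt_mul_const_matrix {N : ℕ} {X : ℝ → Matrix (Fin N) (Fin N) ℝ}
    {X' : Matrix (Fin N) (Fin N) ℝ} {ξ : ℝ} (hX : HasDerivAt X X' ξ)
    (M : Matrix (Fin N) (Fin N) ℝ) : HasDerivAt (fun t => X t * M) (X' * M) ξ :=
  hX.mul_const M

lemma isSymm_deriv {N : ℕ} {X : ℝ → Matrix (Fin N) (Fin N) ℝ}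
    {X' : Matrix (Fin N) (Fin N) ℝ} {ξ : ℝ} (hX : HasDerivAt X X' ξ)
    (hs : ∀ t, (X t).IsSymm) : X'.IsSymm := by
  ext i j
  refine (hX.matrix_apply j i).unique ?_
  simpa only [(hs _).apply] using hX.matrix_apply i j

/-- Along a harmonic-Einstein curve the matrix `G⁻¹ G'` is constant. -/
lemma harmonicEinstein_inv_mul_deriv_eq {N : ℕ} {G G' G'' : ℝ → Matrix (Fin N) (Fin N) ℝ}
    (hG : ∀ ξ, HasDerivAt G (G' ξ) ξ) (hG' : ∀ ξ, HasDerivAt G' (G'' ξ) ξ)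
    (hu : ∀ ξ, IsUnit (G ξ)) (hHE : ∀ ξ, G'' ξ = G' ξ * (G ξ)⁻¹ * G' ξ) (ξ η : ℝ) :
    (G ξ)⁻¹ * G' ξ = (G η)⁻¹ * G' η := by
  have h : ∀ t, HasDerivAt (fun t => (G t)⁻¹ * G' t) 0 t := fun t => by
    refine (((hG t).matrix_inv (hu t)).mul (hG' t)).congr_deriv ?_
    rw [hHE]
    noncomm_ring
  exact is_const_of_deriv_eq_zero (fun t => (h t).differentiableAt) (fun t => (h t).deriv) ξ η

/-- The derivative of `⟨G', h⟩_G` is the coupling term `F h`. -/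
lemma hasDerivAt_innerG_deriv {N : ℕ} {G G' G'' h h' : ℝ → Matrix (Fin N) (Fin N) ℝ}
    (hG : ∀ ξ, HasDerivAt G (G' ξ) ξ) (hG' : ∀ ξ, HasDerivAt G' (G'' ξ) ξ)
    (hh : ∀ ξ, HasDerivAt h (h' ξ) ξ) (hsymm : ∀ ξ, (h ξ).IsSymm)
    (hu : ∀ ξ, IsUnit (G ξ)) (hHE : ∀ ξ, G'' ξ = G' ξ * (G ξ)⁻¹ * G' ξ) (ξ : ℝ) :
    HasDerivAt (fun t => innerG (G t) (G' t) (h t)) (Fop G G' G'' h h' ξ) ξ := by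
  have hK := (hG ξ).matrix_inv (hu ξ)
  have h1 := (((hK.mul (hG' ξ)).mul hK).mul (hh ξ)).matrix_trace
  simp only [innerG, Fop, (hsymm _).eq, (isSymm_deriv (hh ξ) hsymm).eq]
  refine h1.congr_deriv ?_
  rw [hHE, ← trace_sub]
  congr 1
  simp only [Pi.mul_apply]
  noncomm_ring

/-- The derivative of `tr ((G⁻¹ h)' M)` is `⟨L₂ h, G M⟩_G` if `G⁻¹ G'` commutes with `M`. -/
lemma hasDerivAt_trace_mul_const {N : ℕ} {G G' G'' h h' h'' : ℝ → Matrix (Fin N) (Fin N) ℝ}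
    {M : Matrix (Fin N) (Fin N) ℝ}
    (hG : ∀ ξ, HasDerivAt G (G' ξ) ξ) (hG' : ∀ ξ, HasDerivAt G' (G'' ξ) ξ)
    (hh : ∀ ξ, HasDerivAt h (h' ξ) ξ) (hh' : ∀ ξ, HasDerivAt h' (h'' ξ) ξ)
    (hu : ∀ ξ, IsUnit (G ξ)) (hHE : ∀ ξ, G'' ξ = G' ξ * (G ξ)⁻¹ * G' ξ)
    (hGM : ∀ ξ, (G ξ * M).IsSymm)
    (hcomm : ∀ ξ, (G ξ)⁻¹ * G' ξ * M = M * ((G ξ)⁻¹ * G' ξ)) (ξ : ℝ) :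
    HasDerivAt (fun t => (((G t)⁻¹ * h' t - (G t)⁻¹ * G' t * (G t)⁻¹ * h t) * M).trace)
      (innerG (G ξ) (L2 G G' h h' h'' ξ) (G ξ * M)) ξ := by
  have hK := (hG ξ).matrix_inv (hu ξ)
  have h1 := (((hK.mul (hh' ξ)).sub
    (((hK.mul (hG' ξ)).mul hK).mul (hh ξ))).mul_const M).matrix_trace
  have hGK : (G ξ)⁻¹ * G ξ = 1 := nonsing_inv_mul _ ((isUnit_iff_isUnit_det _).1 (hu ξ))
  refine h1.congr_deriv ?_
  rw [innerG, (hGM ξ).eq, hHE, L2]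
  have hc := hcomm ξ
  simp only [Pi.mul_apply]
  set K := (G ξ)⁻¹
  set A := K * G' ξ with hA
  have e1 : K * (h'' ξ - h' ξ * K * G' ξ - G' ξ * K * h' ξ + G' ξ * K * h ξ * K * G' ξ) * K *
      (G ξ * M) = K * h'' ξ * M - K * h' ξ * (A * M) - A * (K * h' ξ * M)
        + A * (K * h ξ) * (A * M) := by
    have : ∀ X : Matrix (Fin N) (Fin N) ℝ, X * K * (G ξ * M) = X * M := fun X => by
      rw [mul_assoc, ← mul_assoc K, hGK, one_mul]
    rw [this, hA]
    noncomm_ring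
  have e2 : (-(A * K) * h' ξ + K * h'' ξ - (((-(A * K) * G' ξ + K * (G' ξ * K * G' ξ)) * K +
      A * -(A * K)) * h ξ + A * K * h' ξ)) * M =
      K * h'' ξ * M - A * (K * h' ξ * M) - A * (K * h' ξ * M) + A * (A * (K * h ξ) * M) := by
    rw [hA]
    noncomm_ring
  have t1 : (K * h' ξ * (A * M)).trace = (A * (K * h' ξ * M)).trace := by
    rw [hc, ← mul_assoc, trace_mul_comm]
  have t2 : (A * (K * h ξ) * (A * M)).trace = (A * (A * (K * h ξ) * M)).trace := by
    rw [hc, ← mul_assoc, trace_mul_comm]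
  refine (congrArg trace e2).trans (Eq.trans ?_ (congrArg trace e1).symm)
  simp only [trace_add, trace_sub, t1, t2]

end MatrixCalculus

section Algebra

variable {N : ℕ}

lemma inv_mul_congruence {Λ : Matrix (Fin N) (Fin N) ℝ} (hΛ : IsUnit Λ)
    (G φ : Matrix (Fin N) (Fin N) ℝ) :
    (Λᵀ * G * Λ)⁻¹ * (Λᵀ * φ * Λ) = Λ⁻¹ * (G⁻¹ * φ) * Λ := by
  have hdt : IsUnit Λᵀ.det := by rwa [det_transpose, ← isUnit_iff_isUnit_det]
  rw [Matrix.mul_inv_rev, Matrix.mul_inv_rev]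
  calc Λ⁻¹ * (G⁻¹ * Λᵀ⁻¹) * (Λᵀ * φ * Λ) = Λ⁻¹ * G⁻¹ * (Λᵀ⁻¹ * Λᵀ) * φ * Λ := by noncomm_ring
    _ = Λ⁻¹ * (G⁻¹ * φ) * Λ := by rw [nonsing_inv_mul _ hdt]; noncomm_ring

lemma conj_mul_conj {Λ : Matrix (Fin N) (Fin N) ℝ} (hΛ : IsUnit Λ)
    (X Y : Matrix (Fin N) (Fin N) ℝ) :
    (Λ⁻¹ * X * Λ) * (Λ⁻¹ * Y * Λ) = Λ⁻¹ * (X * Y) * Λ := by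
  calc _ = Λ⁻¹ * X * (Λ * Λ⁻¹) * Y * Λ := by noncomm_ring
    _ = _ := by
      rw [mul_nonsing_inv _ ((isUnit_iff_isUnit_det _).1 hΛ)]
      noncomm_ring

lemma innerG_congruence {Λ : Matrix (Fin N) (Fin N) ℝ} (hΛ : IsUnit Λ)
    (G φ : Matrix (Fin N) (Fin N) ℝ) {ψ : Matrix (Fin N) (Fin N) ℝ} (hψ : ψ.IsSymm) :
    innerG (Λᵀ * G * Λ) (Λᵀ * φ * Λ) (Λᵀ * ψ * Λ) = innerG G φ ψ := by
  have ht : (Λᵀ * ψ * Λ)ᵀ = Λᵀ * ψ * Λ := by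
    simp only [transpose_mul, transpose_transpose, hψ.eq, mul_assoc]
  rw [innerG, ht, mul_assoc, inv_mul_congruence hΛ, inv_mul_congruence hΛ, conj_mul_conj hΛ,
    trace_conj' hΛ, innerG, hψ.eq, ← mul_assoc]

lemma innerG_add_left (G φ χ ψ : Matrix (Fin N) (Fin N) ℝ) :
    innerG G (φ + χ) ψ = innerG G φ ψ + innerG G χ ψ := by
  simp only [innerG, mul_add, add_mul, trace_add]

lemma innerG_add_right (G φ ψ χ : Matrix (Fin N) (Fin N) ℝ) :
    innerG G φ (ψ + χ) = innerG G φ ψ + innerG G φ χ := by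
  simp only [innerG, transpose_add, mul_add, trace_add]

lemma innerG_smul_left (c : ℝ) (G φ ψ : Matrix (Fin N) (Fin N) ℝ) :
    innerG G (c • φ) ψ = c * innerG G φ ψ := by
  simp only [innerG, mul_smul_comm, smul_mul_assoc, trace_smul, smul_eq_mul]

lemma innerG_smul_right (c : ℝ) (G φ ψ : Matrix (Fin N) (Fin N) ℝ) :
    innerG G φ (c • ψ) = c * innerG G φ ψ := by
  simp only [innerG, transpose_smul, mul_smul_comm, trace_smul, smul_eq_mul]

lemma innerG_comm {G φ ψ : Matrix (Fin N) (Fin N) ℝ} (hφ : φ.IsSymm) (hψ : ψ.IsSymm) :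
    innerG G φ ψ = innerG G ψ φ := by
  rw [innerG, innerG, hφ.eq, hψ.eq, mul_assoc, trace_mul_comm, ← mul_assoc]

/-- The weighted Young inequality for `innerG`. -/
lemma neg_mul_innerG_le {G φ ψ : Matrix (Fin N) (Fin N) ℝ} (hG : G.PosDef) (hφ : φ.IsSymm)
    (hψ : ψ.IsSymm) {lam : ℝ} (hlam : 0 < lam) (c : ℝ) :
    -(c * innerG G φ ψ) ≤ lam / 2 * innerG G ψ ψ + innerG G φ φ / (2 * lam) * c ^ 2 := by
  have h := innerG_self_nonneg hG (c • φ + lam • ψ)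
  simp only [innerG_add_left, innerG_add_right, innerG_smul_left, innerG_smul_right,
    innerG_comm hψ hφ] at h
  rw [← sub_nonneg]
  have e : lam / 2 * innerG G ψ ψ + innerG G φ φ / (2 * lam) * c ^ 2 - -(c * innerG G φ ψ) =
      (c * (c * innerG G φ φ + lam * innerG G φ ψ) +
        lam * (c * innerG G φ ψ + lam * innerG G ψ ψ)) / (2 * lam) := by
    field_simp
    ring
  rw [e]
  exact div_nonneg h (by positivity)

/-- `G M` lies in the kernel of `L₂`. -/
lemma L2_mul_const_add {G G' G'' h h' h'' : ℝ → Matrix (Fin N) (Fin N) ℝ}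
    {M : Matrix (Fin N) (Fin N) ℝ} {ξ : ℝ} (hu : IsUnit (G ξ))
    (hHE : G'' ξ = G' ξ * (G ξ)⁻¹ * G' ξ) :
    L2 G G' (fun t => G t * M + h t) (fun t => G' t * M + h' t) (fun t => G'' t * M + h'' t) ξ =
      L2 G G' h h' h'' ξ := by
  have hK : G' ξ * (G ξ)⁻¹ * (G ξ * M + h ξ) = G' ξ * M + G' ξ * (G ξ)⁻¹ * h ξ := by
    rw [mul_add, mul_assoc (G' ξ), ← mul_assoc (G ξ)⁻¹,
      nonsing_inv_mul _ ((isUnit_iff_isUnit_det _).1 hu), one_mul]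
  simp only [L2]
  rw [hK, hHE]
  noncomm_ring

/-- `G M` lies in the kernel of the coupling term. -/
lemma Fop_mul_const_add {G G' G'' h h' : ℝ → Matrix (Fin N) (Fin N) ℝ}
    {M : Matrix (Fin N) (Fin N) ℝ} {ξ : ℝ} (hu : IsUnit (G ξ))
    (hHE : G'' ξ = G' ξ * (G ξ)⁻¹ * G' ξ) (hGM : (G ξ * M).IsSymm) (hG'M : (G' ξ * M).IsSymm) :
    Fop G G' G'' (fun t => G t * M + h t) (fun t => G' t * M + h' t) ξ = Fop G G' G'' h h' ξ := by
  have e : innerG (G ξ) (G' ξ) (G' ξ * M) = innerG (G ξ) (G'' ξ) (G ξ * M) := by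
    rw [innerG, innerG, hGM.eq, hG'M.eq, hHE, mul_assoc _ (G ξ)⁻¹ (G ξ * M),
      ← mul_assoc (G ξ)⁻¹ (G ξ), nonsing_inv_mul _ ((isUnit_iff_isUnit_det _).1 hu), one_mul]
    simp only [mul_assoc]
  simp only [Fop, innerG_add_right, e]
  ring

/-- If `G M` and `G' M` are symmetric then `G⁻¹ G'` commutes with `M`. -/
lemma inv_mul_deriv_commute {G G' M : Matrix (Fin N) (Fin N) ℝ} (hu : IsUnit G) (hG : G.IsSymm)
    (hG' : G'.IsSymm) (hGM : (G * M).IsSymm) (hG'M : (G' * M).IsSymm) :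
    G⁻¹ * G' * M = M * (G⁻¹ * G') := by
  have hd := (isUnit_iff_isUnit_det _).1 hu
  have h1 : Mᵀ * G = G * M := by simpa only [transpose_mul, hG.eq] using hGM.eq
  have h2 : Mᵀ * G' = G' * M := by simpa only [transpose_mul, hG'.eq] using hG'M.eq
  calc G⁻¹ * G' * M = G⁻¹ * (Mᵀ * (G * G⁻¹)) * G' := by
        rw [mul_nonsing_inv _ hd, mul_one, mul_assoc, ← h2, mul_assoc]
    _ = G⁻¹ * G * M * G⁻¹ * G' := by rw [← mul_assoc Mᵀ, h1]; simp only [mul_assoc]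
    _ = M * (G⁻¹ * G') := by rw [nonsing_inv_mul _ hd, one_mul, mul_assoc]

lemma trace_boundary_eq {Λ M : Matrix (Fin N) (Fin N) ℝ} (hΛ : IsUnit Λ) (hMΛ : M * Λ = Λ * M)
    {G G' h h' : ℝ → Matrix (Fin N) (Fin N) ℝ} (hG : holBC Λ G) (hG' : holBC Λ G')
    (hh : holBC Λ h) (hh' : holBC Λ h') :
    (((G 1)⁻¹ * h' 1 - (G 1)⁻¹ * G' 1 * (G 1)⁻¹ * h 1) * M).trace =
      (((G 0)⁻¹ * h' 0 - (G 0)⁻¹ * G' 0 * (G 0)⁻¹ * h 0) * M).trace := by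
  simp only [holBC] at hG hG' hh hh'
  have hM : M = Λ⁻¹ * M * Λ := by
    rw [mul_assoc, hMΛ, ← mul_assoc, nonsing_inv_mul _ ((isUnit_iff_isUnit_det _).1 hΛ), one_mul]
  rw [hG, hG', hh, hh', mul_assoc (_ * _) _ (Λᵀ * h 0 * Λ), inv_mul_congruence hΛ,
    inv_mul_congruence hΛ, inv_mul_congruence hΛ, conj_mul_conj hΛ, ← sub_mul, ← mul_sub]
  conv_lhs => rw [hM]
  rw [conj_mul_conj hΛ, trace_conj' hΛ]
  simp only [mul_assoc]

end Algebra

lemma continuous_of_hasDerivAt_matrix {N : ℕ} {X X' : ℝ → Matrix (Fin N) (Fin N) ℝ}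
    (hX : ∀ ξ, HasDerivAt X (X' ξ) ξ) : Continuous X :=
  continuous_matrix fun i j =>
    continuous_iff_continuousAt.2 fun ξ => ((hX ξ).matrix_apply i j).continuousAt

lemma ContDiff.continuous_second_deriv {f f' f'' : ℝ → ℝ} (hf : ContDiff ℝ (⊤ : ℕ∞) f)
    (h1 : ∀ ξ, HasDerivAt f (f' ξ) ξ) (h2 : ∀ ξ, HasDerivAt f' (f'' ξ) ξ) : Continuous f'' := by
  have e1 : deriv f = f' := funext fun ξ => (h1 ξ).deriv
  have e2 : deriv f' = f'' := funext fun ξ => (h2 ξ).deriv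
  have h := (contDiff_infty_iff_deriv.1 (contDiff_infty_iff_deriv.1 hf).2).2.continuous
  rwa [e1, e2] at h

theorem weak_linear_stability_full_linearization {N : ℕ} (hN : 0 < N)
    (Λ : Matrix (Fin N) (Fin N) ℝ) (hΛ : IsUnit Λ)
    (G G' G'' : ℝ → Matrix (Fin N) (Fin N) ℝ)
    (hGsmooth : ∀ i j, ContDiff ℝ (⊤ : ℕ∞) fun ξ => G ξ i j)
    (hGderiv : ∀ ξ i j, HasDerivAt (fun t => G t i j) (G' ξ i j) ξ)
    (hGderiv2 : ∀ ξ i j, HasDerivAt (fun t => G' t i j) (G'' ξ i j) ξ)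
    (hGpos : ∀ ξ, (G ξ).PosDef)
    (hHE : ∀ ξ, G'' ξ = G' ξ * (G ξ)⁻¹ * G' ξ)
    (hGbc : holBC Λ G) (hG'bc : holBC Λ G')
    (s : ℝ) (hs : s = (1/2) * innerG (G 0) (G' 0) (G' 0)) (hspos : 0 < s)
    (lam : ℝ) (hlam : 0 < lam) (C : ℝ) (hC : s / lam ≤ C)
    (M : Matrix (Fin N) (Fin N) ℝ) (hMΛ : M * Λ = Λ * M)
    (hGM : ∀ ξ, (G ξ * M).IsSymm)
    (hp hp' hp'' : ℝ → Matrix (Fin N) (Fin N) ℝ)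
    (hpsmooth : ∀ i j, ContDiff ℝ (⊤ : ℕ∞) fun ξ => hp ξ i j)
    (hpderiv : ∀ ξ i j, HasDerivAt (fun t => hp t i j) (hp' ξ i j) ξ)
    (hpderiv2 : ∀ ξ i j, HasDerivAt (fun t => hp' t i j) (hp'' ξ i j) ξ)
    (hpsymm : ∀ ξ, (hp ξ).IsSymm)
    (hpbc : holBC Λ hp) (hp'bc : holBC Λ hp')
    (hquad : (∫ ξ in (0:ℝ)..1, innerG (G ξ) (L2 G G' hp hp' hp'' ξ) (hp ξ)) ≤
      -lam * ∫ ξ in (0:ℝ)..1, innerG (G ξ) (hp ξ) (hp ξ))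
    (h h' h'' : ℝ → Matrix (Fin N) (Fin N) ℝ)
    (hdef : h = fun ξ => G ξ * M + hp ξ)
    (hdef' : h' = fun ξ => G' ξ * M + hp' ξ)
    (hdef'' : h'' = fun ξ => G'' ξ * M + hp'' ξ)
    (v v' v'' : ℝ → ℝ)
    (hvsmooth : ContDiff ℝ (⊤ : ℕ∞) v)
    (hvderiv : ∀ ξ, HasDerivAt v (v' ξ) ξ)
    (hvderiv2 : ∀ ξ, HasDerivAt v' (v'' ξ) ξ)
    (hvbc : v 0 = v 1) (hv'bc : v' 0 = v' 1)
    (B B' B'' : ℝ → Fin N → ℝ)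
    (hBsmooth : ∀ i, ContDiff ℝ (⊤ : ℕ∞) fun ξ => B ξ i)
    (hBderiv : ∀ ξ i, HasDerivAt (fun t => B t i) (B' ξ i) ξ)
    (hBderiv2 : ∀ ξ i, HasDerivAt (fun t => B' t i) (B'' ξ i) ξ)
    (hBbc : B 0 = B 1) (hB'bc : B' 0 = B' 1) :
    (∫ ξ in (0:ℝ)..1,
        ((C * v'' ξ - s * v ξ + Fop G G' G'' h h' ξ) * v ξ
          + (B'' ξ - (s / 2) • B ξ) ⬝ᵥ B ξ
          + innerG (G ξ) (L2 G G' h h' h'' ξ) (h ξ))) ≤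
      -s * (∫ ξ in (0:ℝ)..1, (v ξ) ^ 2)
        - (s / 2) * (∫ ξ in (0:ℝ)..1, B ξ ⬝ᵥ B ξ)
        - (lam / 2) * ∫ ξ in (0:ℝ)..1, innerG (G ξ) (hp ξ) (hp ξ) := by
  have hu : ∀ ξ, IsUnit (G ξ) := fun ξ => (hGpos ξ).isUnit
  have dG : ∀ ξ, HasDerivAt G (G' ξ) ξ := fun ξ => hasDerivAt_matrix (hGderiv ξ)
  have dG' : ∀ ξ, HasDerivAt G' (G'' ξ) ξ := fun ξ => hasDerivAt_matrix (hGderiv2 ξ)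
  have dh : ∀ ξ, HasDerivAt hp (hp' ξ) ξ := fun ξ => hasDerivAt_matrix (hpderiv ξ)
  have dh' : ∀ ξ, HasDerivAt hp' (hp'' ξ) ξ := fun ξ => hasDerivAt_matrix (hpderiv2 ξ)
  have sG : ∀ ξ, (G ξ).IsSymm := fun ξ => by
    simpa only [IsSymm, conjTranspose_eq_transpose_of_trivial] using (hGpos ξ).isHermitian.eq
  have sG' : ∀ ξ, (G' ξ).IsSymm := fun ξ => isSymm_deriv (dG ξ) sG
  have sG'M : ∀ ξ, (G' ξ * M).IsSymm := fun ξ =>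
    isSymm_deriv (hasDerivAt_mul_const_matrix (dG ξ) M) hGM
  have hcomm : ∀ ξ, (G ξ)⁻¹ * G' ξ * M = M * ((G ξ)⁻¹ * G' ξ) := fun ξ =>
    inv_mul_deriv_commute (hu ξ) (sG ξ) (sG' ξ) (hGM ξ) (sG'M ξ)
  have hs' : ∀ ξ, innerG (G ξ) (G' ξ) (G' ξ) = 2 * s := fun ξ => by
    have e := harmonicEinstein_inv_mul_deriv_eq dG dG' hu hHE ξ 0
    rw [hs, innerG, innerG, (sG' ξ).eq, (sG' 0).eq, mul_assoc, mul_assoc _ (G 0)⁻¹, e]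
    ring
  have dF := hasDerivAt_innerG_deriv dG dG' dh hpsymm hu hHE
  have dT := hasDerivAt_trace_mul_const dG dG' dh dh' hu hHE hGM hcomm
  have cG : Continuous G := continuous_of_hasDerivAt_matrix dG
  have cG' : Continuous G' := continuous_of_hasDerivAt_matrix dG'
  have cK : Continuous fun ξ => (G ξ)⁻¹ := continuous_of_hasDerivAt_matrix fun ξ =>
    (dG ξ).matrix_inv (hu ξ)
  have cG'' : Continuous G'' := by
    rw [funext hHE]
    exact (cG'.mul cK).mul cG'
  have ch : Continuous hp := continuous_of_hasDerivAt_matrix dh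
  have ch' : Continuous hp' := continuous_of_hasDerivAt_matrix dh'
  have ch'' : Continuous hp'' := continuous_matrix fun i j =>
    (hpsmooth i j).continuous_second_deriv (fun ξ => hpderiv ξ i j) (fun ξ => hpderiv2 ξ i j)
  have cv : Continuous v := hvsmooth.continuous
  have cv' : Continuous v' := continuous_iff_continuousAt.2 fun ξ => (hvderiv2 ξ).continuousAt
  have cv'' : Continuous v'' := hvsmooth.continuous_second_deriv hvderiv hvderiv2
  have cB : Continuous B := continuous_pi fun i => (hBsmooth i).continuous
  have cB' : Continuous B' := continuous_pi fun i =>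
    continuous_iff_continuousAt.2 fun ξ => (hBderiv2 ξ i).continuousAt
  have cB'' : Continuous B'' := continuous_pi fun i =>
    (hBsmooth i).continuous_second_deriv (fun ξ => hBderiv ξ i) (fun ξ => hBderiv2 ξ i)
  have cinner : ∀ {φ ψ : ℝ → Matrix (Fin N) (Fin N) ℝ}, Continuous φ → Continuous ψ →
      Continuous fun ξ => innerG (G ξ) (φ ξ) (ψ ξ) := fun hφ hψ =>
    (((cK.mul hφ).mul cK).mul hψ.matrix_transpose).matrix_trace
  have cL : Continuous (L2 G G' hp hp' hp'') :=
    ((ch''.sub ((ch'.mul cK).mul cG')).sub ((cG'.mul cK).mul ch')).add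
      ((((cG'.mul cK).mul ch).mul cK).mul cG')
  have cLh := cinner cL ch
  have cLM := cinner cL (cG.mul continuous_const : Continuous fun ξ => G ξ * M)
  have cFop : Continuous (Fop G G' G'' hp hp') := (cinner cG' ch').sub (cinner cG'' ch)
  have cG'h := cinner cG' ch
  have chh := cinner ch ch
  have cBB : Continuous fun ξ => B ξ ⬝ᵥ B ξ := cB.dotProduct cB
  have cBB' : Continuous fun ξ => B' ξ ⬝ᵥ B' ξ := cB'.dotProduct cB'
  have cBB'' : Continuous fun ξ => B'' ξ ⬝ᵥ B ξ := cB''.dotProduct cB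
  have dB : ∀ ξ, HasDerivAt (fun t => B' t ⬝ᵥ B t) (B'' ξ ⬝ᵥ B ξ + B' ξ ⬝ᵥ B' ξ) ξ := fun ξ => by
    rw [dotProduct, dotProduct, ← Finset.sum_add_distrib]
    exact HasDerivAt.fun_sum fun i _ => (hBderiv2 ξ i).mul (hBderiv ξ i)
  set E : ℝ → ℝ := fun t => C * (v' t * v t) + innerG (G t) (G' t) (hp t) * v t + B' t ⬝ᵥ B t
    + (((G t)⁻¹ * hp' t - (G t)⁻¹ * G' t * (G t)⁻¹ * hp t) * M).trace with hE
  set E' : ℝ → ℝ := fun ξ => C * (v'' ξ * v ξ + v' ξ * v' ξ)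
    + (Fop G G' G'' hp hp' ξ * v ξ + innerG (G ξ) (G' ξ) (hp ξ) * v' ξ)
    + (B'' ξ ⬝ᵥ B ξ + B' ξ ⬝ᵥ B' ξ)
    + innerG (G ξ) (L2 G G' hp hp' hp'' ξ) (G ξ * M) with hE'
  have dE : ∀ ξ, HasDerivAt E (E' ξ) ξ := fun ξ =>
    (((((hvderiv2 ξ).mul (hvderiv ξ)).const_mul C).add ((dF ξ).mul (hvderiv ξ))).add (dB ξ)).add
      (dT ξ)
  have cE' : Continuous E' := by fun_prop
  have hbdry : E 1 = E 0 := by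
    have e := innerG_congruence hΛ (G 0) (G' 0) (hpsymm 0)
    rw [← hGbc, ← hG'bc, ← hpbc] at e
    simp only [hE, trace_boundary_eq hΛ hMΛ hGbc hG'bc hpbc hp'bc, e, hvbc, hv'bc, hBbc, hB'bc]
  have intE : ∫ ξ in (0:ℝ)..1, E' ξ = 0 := by
    rw [intervalIntegral.integral_eq_sub_of_hasDerivAt (fun ξ _ => dE ξ)
      (cE'.intervalIntegrable _ _), hbdry, sub_self]
  subst hdef hdef' hdef''
  have hrewrite : ∀ ξ, (C * v'' ξ - s * v ξ
      + Fop G G' G'' (fun ξ => G ξ * M + hp ξ) (fun ξ => G' ξ * M + hp' ξ) ξ) * v ξ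
      + (B'' ξ - (s / 2) • B ξ) ⬝ᵥ B ξ
      + innerG (G ξ) (L2 G G' (fun ξ => G ξ * M + hp ξ) (fun ξ => G' ξ * M + hp' ξ)
        (fun ξ => G'' ξ * M + hp'' ξ) ξ) (G ξ * M + hp ξ) =
      E' ξ - C * v' ξ ^ 2 - v' ξ * innerG (G ξ) (G' ξ) (hp ξ) - B' ξ ⬝ᵥ B' ξ
        - s * v ξ ^ 2 - s / 2 * (B ξ ⬝ᵥ B ξ)
        + innerG (G ξ) (L2 G G' hp hp' hp'' ξ) (hp ξ) := fun ξ => by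
    rw [L2_mul_const_add (hu ξ) (hHE ξ), Fop_mul_const_add (hu ξ) (hHE ξ) (hGM ξ) (sG'M ξ),
      innerG_add_right, sub_dotProduct, smul_dotProduct, smul_eq_mul]
    simp only [hE']
    ring
  have hpt : ∀ ξ, E' ξ - C * v' ξ ^ 2 - v' ξ * innerG (G ξ) (G' ξ) (hp ξ) - B' ξ ⬝ᵥ B' ξ
        - s * v ξ ^ 2 - s / 2 * (B ξ ⬝ᵥ B ξ)
        + innerG (G ξ) (L2 G G' hp hp' hp'' ξ) (hp ξ) ≤
      E' ξ + lam / 2 * innerG (G ξ) (hp ξ) (hp ξ) - s * v ξ ^ 2 - s / 2 * (B ξ ⬝ᵥ B ξ)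
        + innerG (G ξ) (L2 G G' hp hp' hp'' ξ) (hp ξ) := fun ξ => by
    have hY := neg_mul_innerG_le (hGpos ξ) (sG' ξ) (hpsymm ξ) hlam (v' ξ)
    rw [hs' ξ, mul_div_mul_left _ _ two_ne_zero] at hY
    have hCv := mul_le_mul_of_nonneg_right hC (sq_nonneg (v' ξ))
    have hBn : 0 ≤ B' ξ ⬝ᵥ B' ξ := Finset.sum_nonneg fun i _ => mul_self_nonneg _
    linarith
  simp only [hrewrite]
  refine (intervalIntegral.integral_mono_on zero_le_one
    (Continuous.intervalIntegrable (by fun_prop) _ _)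
    (Continuous.intervalIntegrable (by fun_prop) _ _) fun ξ _ => hpt ξ).trans ?_
  have ii : ∀ {f : ℝ → ℝ}, Continuous f → IntervalIntegrable f MeasureTheory.volume 0 1 :=
    fun hf => hf.intervalIntegrable _ _
  rw [intervalIntegral.integral_add (ii (by fun_prop)) (ii (by fun_prop)),
    intervalIntegral.integral_sub (ii (by fun_prop)) (ii (by fun_prop)),
    intervalIntegral.integral_sub (ii (by fun_prop)) (ii (by fun_prop)),
    intervalIntegral.integral_add (ii (by fun_prop)) (ii (by fun_prop)), intE]
  simp only [intervalIntegral.integral_const_mul]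
  linarith
end

section
/- Let N be a positive integer, let G be a smooth harmonic-Einstein map from ℝ to the symmetric positive-definite real N×N matrices, and let M be a real N×N matrix such that G(ξ)M is symmetric for every ξ. Define h(ξ) = G(ξ)M. Then (F h)(ξ) = 0 for all ξ; that is, ⟨G'(ξ), h'(ξ)⟩_{G(ξ)} = ⟨G''(ξ), h(ξ)⟩_{G(ξ)} pointwise. -/
open Matrix

/-- The derivative of a path of symmetric matrices is symmetric. -/
theorem isSymm_of_hasDerivAt {n : Type*} {G : ℝ → Matrix n n ℝ} {A : Matrix n n ℝ} {ξ : ℝ}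
    (hG : ∀ t, (G t).IsSymm) (hA : ∀ i j, HasDerivAt (fun t => G t i j) (A i j) ξ) :
    A.IsSymm := by
  refine Matrix.IsSymm.ext fun i j => (hA j i).unique ?_
  simpa only [(hG _).apply] using hA i j

/-- `⟨A, A M⟩_G = ⟨A G⁻¹ A, G M⟩_G` for symmetric `A` and symmetric invertible `G`. -/
theorem innerG_mul_right_eq {N : ℕ} {G A : Matrix (Fin N) (Fin N) ℝ} (hG : G.IsSymm)
    (hdet : IsUnit G.det) (hA : A.IsSymm) (M : Matrix (Fin N) (Fin N) ℝ) :
    innerG G A (A * M) = innerG G (A * G⁻¹ * A) (G * M) := by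
  unfold innerG
  rw [Matrix.transpose_mul, Matrix.transpose_mul, hG.eq, hA.eq, ← Matrix.mul_assoc,
    Matrix.trace_mul_comm, ← Matrix.mul_assoc _ _ G, Matrix.trace_mul_comm _ G]
  simp only [Matrix.mul_assoc, Matrix.mul_nonsing_inv_cancel_left _ _ hdet]

theorem Fop_vanishes_on_nullspace {N : ℕ} (hN : 0 < N)
    (G G' G'' : ℝ → Matrix (Fin N) (Fin N) ℝ)
    (hGsmooth : ∀ i j, ContDiff ℝ (⊤ : ℕ∞) fun ξ => G ξ i j)
    (hGderiv : ∀ ξ i j, HasDerivAt (fun t => G t i j) (G' ξ i j) ξ)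
    (hGderiv2 : ∀ ξ i j, HasDerivAt (fun t => G' t i j) (G'' ξ i j) ξ)
    (hGpos : ∀ ξ, (G ξ).PosDef)
    (hHE : ∀ ξ, G'' ξ = G' ξ * (G ξ)⁻¹ * G' ξ)
    (M : Matrix (Fin N) (Fin N) ℝ)
    (hGM : ∀ ξ, (G ξ * M).IsSymm) :
    ∀ ξ : ℝ,
      Fop G G' G'' (fun t => G t * M) (fun t => G' t * M) ξ = 0 ∧
      innerG (G ξ) (G' ξ) (G' ξ * M) = innerG (G ξ) (G'' ξ) (G ξ * M) := by
  intro ξ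
  have hsymm : ∀ t, (G t).IsSymm := fun t => by
    simpa [Matrix.IsHermitian, Matrix.IsSymm] using (hGpos t).isHermitian
  have key : innerG (G ξ) (G' ξ) (G' ξ * M) = innerG (G ξ) (G'' ξ) (G ξ * M) := by
    rw [hHE ξ]
    exact innerG_mul_right_eq (hsymm ξ) (hGpos ξ).det_pos.ne'.isUnit
      (isSymm_of_hasDerivAt hsymm (hGderiv ξ)) M
  exact ⟨sub_eq_zero.mpr key, key⟩
end

section
/- Let N be a positive integer and let G̃ : ℝ × ℝ → (symmetric positive-definite real N×N matrices) be a smooth two-parameter family. Write G(ξ) = G̃(ξ,0) and h(ξ) = ∂_ε G̃(ξ,ε)|_{ε=0}, and suppose that G is harmonic-Einstein. Then for every ξ, (∂/∂ε) tr( (G̃(ξ,ε)⁻¹ ∂_ξ G̃(ξ,ε))² ) |_{ε=0} = 2 ⟨G'(ξ), h'(ξ)⟩_{G(ξ)} − 2 ⟨G''(ξ), h(ξ)⟩_{G(ξ)}. -/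
open Matrix

/-- Equality of mixed partial derivatives, phrased with one-variable derivatives. -/
theorem hasDerivAt_partial_of_contDiff {f : ℝ × ℝ → ℝ} (hf : ContDiff ℝ 2 f)
    {fx : ℝ → ℝ → ℝ} (hfx : ∀ x y, HasDerivAt (fun t => f (t, y)) (fx x y) x)
    {y : ℝ} {fy : ℝ → ℝ} (hfy : ∀ x, HasDerivAt (fun t => f (x, t)) (fy x) y)
    {x fyx : ℝ} (hfyx : HasDerivAt fy fyx x) :
    HasDerivAt (fun t => fx x t) fyx y := by
  have hline₁ (x y : ℝ) : HasDerivAt (fun t : ℝ => (t, y)) ((1 : ℝ), (0 : ℝ)) x :=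
    (hasDerivAt_id x).prodMk (hasDerivAt_const x y)
  have hline₂ (x y : ℝ) : HasDerivAt (fun t : ℝ => (x, t)) ((0 : ℝ), (1 : ℝ)) y :=
    (hasDerivAt_const y x).prodMk (hasDerivAt_id y)
  have hf₁ : Differentiable ℝ f := hf.differentiable (by norm_num)
  have hf₂ : Differentiable ℝ (fderiv ℝ f) :=
    (hf.fderiv_right (m := 1) (by norm_num)).differentiable (by norm_num)
  have hfx_eq (x y : ℝ) : fx x y = fderiv ℝ f (x, y) (1, 0) :=
    (hfx x y).unique ((hf₁ (x, y)).hasFDerivAt.comp_hasDerivAt x (hline₁ x y))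
  have hfy_eq (x : ℝ) : fy x = fderiv ℝ f (x, y) (0, 1) :=
    (hfy x).unique ((hf₁ (x, y)).hasFDerivAt.comp_hasDerivAt y (hline₂ x y))
  have hsymm : IsSymmSndFDerivAt ℝ f (x, y) :=
    hf.contDiffAt.isSymmSndFDerivAt (by simp)
  have hyx : HasDerivAt fy (fderiv ℝ (fderiv ℝ f) (x, y) (1, 0) (0, 1)) x := by
    rw [funext hfy_eq]
    exact (ContinuousLinearMap.apply ℝ ℝ ((0 : ℝ), (1 : ℝ))).hasFDerivAt.comp_hasDerivAt x
      ((hf₂ (x, y)).hasFDerivAt.comp_hasDerivAt x (hline₁ x y))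
  rw [hfyx.unique hyx, hsymm.eq, funext (hfx_eq x)]
  exact (ContinuousLinearMap.apply ℝ ℝ ((1 : ℝ), (0 : ℝ))).hasFDerivAt.comp_hasDerivAt y
    ((hf₂ (x, y)).hasFDerivAt.comp_hasDerivAt y (hline₂ x y))

section MatrixCalculus

attribute [local instance] Matrix.linftyOpNormedRing Matrix.linftyOpNormedAlgebra

variable {n : Type*} [Fintype n] [DecidableEq n]

theorem Matrix.hasDerivAt_of_entries {A : ℝ → Matrix n n ℝ} {A' : Matrix n n ℝ} {x : ℝ}
    (hA : ∀ i j, HasDerivAt (fun t => A t i j) (A' i j) x) : HasDerivAt A A' x := by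
  have hsum (B : Matrix n n ℝ) : B = ∑ i, ∑ j, B i j • Matrix.single i j (1 : ℝ) := by
    simpa using Matrix.matrix_eq_sum_single B
  rw [funext fun t => hsum (A t), hsum A']
  exact HasDerivAt.fun_sum fun i _ => HasDerivAt.fun_sum fun j _ => (hA i j).smul_const _

theorem Matrix.hasDerivAt_inv {A : ℝ → Matrix n n ℝ} {A' : Matrix n n ℝ} {x : ℝ}
    (hA : HasDerivAt A A' x) (hx : IsUnit (A x)) :
    HasDerivAt (fun t => (A t)⁻¹) (-((A x)⁻¹ * A' * (A x)⁻¹)) x := by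
  obtain ⟨u, hu⟩ := hx
  have hinv := hasFDerivAt_ringInverse (𝕜 := ℝ) u
  rw [hu] at hinv
  have hcomp := hinv.comp_hasDerivAt x hA
  simp only [Function.comp_def, ← Matrix.nonsing_inv_eq_ringInverse, Matrix.coe_units_inv, hu,
    _root_.neg_apply, ContinuousLinearMap.mulLeftRight_apply] at hcomp
  exact hcomp

/-- The derivative of `tr ((A⁻¹ P)²)` along a curve of pairs `(A, P)`. -/
theorem Matrix.hasDerivAt_trace_inv_mul_sq {A P : ℝ → Matrix n n ℝ} {A' P' : Matrix n n ℝ}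
    {x : ℝ} (hA : ∀ i j, HasDerivAt (fun t => A t i j) (A' i j) x)
    (hP : ∀ i j, HasDerivAt (fun t => P t i j) (P' i j) x) (hx : IsUnit (A x)) :
    HasDerivAt (fun t => (((A t)⁻¹ * P t) ^ 2).trace)
      (2 * ((A x)⁻¹ * P x * (A x)⁻¹ * P').trace
        - 2 * ((A x)⁻¹ * (P x * (A x)⁻¹ * P x) * (A x)⁻¹ * A').trace) x := by
  have hQ := (Matrix.hasDerivAt_inv (Matrix.hasDerivAt_of_entries hA) hx).fun_mul
    (Matrix.hasDerivAt_of_entries hP)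
  have htr := (Matrix.traceLinearMap n ℝ ℝ).toContinuousLinearMap.hasFDerivAt.comp_hasDerivAt x
    (hQ.fun_mul hQ)
  simp only [pow_two]
  refine htr.congr_deriv ?_
  generalize (A x)⁻¹ = B
  generalize P x = Q
  have h₁ : (B * P' * (B * Q)).trace = (B * Q * B * P').trace := by
    rw [Matrix.trace_mul_comm]; simp only [Matrix.mul_assoc]
  have h₂ : (B * A' * B * Q * (B * Q)).trace = (B * (Q * B * Q) * B * A').trace := by
    rw [show B * A' * B * Q * (B * Q) = (B * A') * (B * Q * B * Q) by
      simp only [Matrix.mul_assoc], Matrix.trace_mul_comm]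
    simp only [Matrix.mul_assoc]
  have h₃ : (B * Q * (B * A' * B * Q)).trace = (B * (Q * B * Q) * B * A').trace := by
    rw [Matrix.trace_mul_comm, h₂]
  have h₄ : (B * Q * (B * P')).trace = (B * Q * B * P').trace := by
    simp only [Matrix.mul_assoc]
  change Matrix.trace _ = _
  simp only [Matrix.add_mul, Matrix.mul_add, Matrix.neg_mul, Matrix.mul_neg, Matrix.trace_add,
    Matrix.trace_neg, h₁, h₂, h₃, h₄]
  ring

end MatrixCalculus

theorem first_variation_of_energy_density {N : ℕ} (hN : 0 < N)
    (Gt : ℝ → ℝ → Matrix (Fin N) (Fin N) ℝ)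
    (hGtsmooth : ∀ i j, ContDiff ℝ (⊤ : ℕ∞) fun p : ℝ × ℝ => Gt p.1 p.2 i j)
    (hGtpos : ∀ ξ ε, (Gt ξ ε).PosDef)
    (Gp : ℝ → ℝ → Matrix (Fin N) (Fin N) ℝ)
    (hGp : ∀ ξ ε i j, HasDerivAt (fun t => Gt t ε i j) (Gp ξ ε i j) ξ)
    (G'' : ℝ → Matrix (Fin N) (Fin N) ℝ)
    (hG'' : ∀ ξ i j, HasDerivAt (fun t => Gp t 0 i j) (G'' ξ i j) ξ)
    (hHE : ∀ ξ, G'' ξ = Gp ξ 0 * (Gt ξ 0)⁻¹ * Gp ξ 0)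
    (h : ℝ → Matrix (Fin N) (Fin N) ℝ)
    (hh : ∀ ξ i j, HasDerivAt (fun ε => Gt ξ ε i j) (h ξ i j) 0)
    (h' : ℝ → Matrix (Fin N) (Fin N) ℝ)
    (hh' : ∀ ξ i j, HasDerivAt (fun t => h t i j) (h' ξ i j) ξ) :
    ∀ ξ : ℝ, HasDerivAt
      (fun ε => ((((Gt ξ ε)⁻¹ * Gp ξ ε)) ^ 2).trace)
      (2 * innerG (Gt ξ 0) (Gp ξ 0) (h' ξ) - 2 * innerG (Gt ξ 0) (G'' ξ) (h ξ))
      0 := by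
  intro ξ
  have hsymm (t ε : ℝ) (i j : Fin N) : Gt t ε j i = Gt t ε i j := by
    simpa using (hGtpos t ε).isHermitian.apply i j
  have hh_symm (t : ℝ) : (h t)ᵀ = h t := by
    ext i j
    have := hh t j i
    simp only [hsymm _ _ i j] at this
    exact this.unique (hh t i j)
  have hh'_symm : (h' ξ)ᵀ = h' ξ := by
    ext i j
    have := hh' ξ j i
    rw [show (fun t => h t j i) = fun t => h t i j from
      funext fun t => congrFun (congrFun (hh_symm t) i) j] at this
    exact this.unique (hh' ξ i j)
  have hGp_deriv (i j : Fin N) : HasDerivAt (fun ε => Gp ξ ε i j) (h' ξ i j) 0 :=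
    hasDerivAt_partial_of_contDiff (f := fun p => Gt p.1 p.2 i j)
      (fx := fun t ε => Gp t ε i j) (contDiff_infty.1 (hGtsmooth i j) 2)
      (fun t ε => hGp t ε i j) (fun t => hh t i j) (hh' ξ i j)
  simp only [innerG, hh_symm, hh'_symm, hHE]
  exact Matrix.hasDerivAt_trace_inv_mul_sq (hh ξ) hGp_deriv (hGtpos ξ 0).isUnit
end

section
/- Let U ⊆ ℝ² be open and let h : U → (symmetric 2×2 real matrices) be continuously differentiable. Suppose h is trace-free, i.e. h₁₁(x) + h₂₂(x) = 0 for all x ∈ U, and divergence-free with respect to the flat metric, i.e. ∂₁h_{1k}(x) + ∂₂h_{2k}(x) = 0 for k = 1, 2 and all x ∈ U. Then the tensor T defined by T_{ijk} = ∂_k h_{ij} − ∂_i h_{jk} vanishes identically on U, i.e. ∂_k h_{ij}(x) = ∂_i h_{jk}(x) for all i, j, k ∈ {1,2} and all x ∈ U. -/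
open Matrix

/-- The partial derivative of `f : ℝ × ℝ → ℝ` in the `i`-th coordinate direction. -/
noncomputable def pd (i : Fin 2) (f : ℝ × ℝ → ℝ) (x : ℝ × ℝ) : ℝ :=
  fderiv ℝ f x (if i = 0 then ((1 : ℝ), (0 : ℝ)) else ((0 : ℝ), (1 : ℝ)))

theorem pd_congr (i : Fin 2) {f g : ℝ × ℝ → ℝ} {x : ℝ × ℝ} (hfg : f =ᶠ[nhds x] g) :
    pd i f x = pd i g x := by
  simp only [pd, hfg.fderiv_eq]

theorem pd_neg (i : Fin 2) (f : ℝ × ℝ → ℝ) (x : ℝ × ℝ) :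
    pd i (fun y => -f y) x = -pd i f x := by
  simp only [pd, fderiv_fun_neg, _root_.neg_apply]

theorem tracefree_divfree_implies_T_vanishes
    (U : Set (ℝ × ℝ)) (hU : IsOpen U)
    (h : ℝ × ℝ → Matrix (Fin 2) (Fin 2) ℝ)
    (hC1 : ∀ i j, ContDiffOn ℝ 1 (fun x => h x i j) U)
    (hsymm : ∀ x ∈ U, (h x).IsSymm)
    (htracefree : ∀ x ∈ U, h x 0 0 + h x 1 1 = 0)
    (hdivfree : ∀ x ∈ U, ∀ k : Fin 2,
      pd 0 (fun y => h y 0 k) x + pd 1 (fun y => h y 1 k) x = 0) :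
    ∀ x ∈ U, ∀ i j k : Fin 2,
      pd k (fun y => h y i j) x = pd i (fun y => h y j k) x := by
  intro x hx
  have hnhds : U ∈ nhds x := hU.mem_nhds hx
  have hpd_symm (l : Fin 2) : pd l (fun y => h y 1 0) x = pd l (fun y => h y 0 1) x :=
    pd_congr l (Filter.mem_of_superset hnhds fun y hy => (hsymm y hy).apply 0 1)
  have hpd_trace (l : Fin 2) : pd l (fun y => h y 1 1) x = -pd l (fun y => h y 0 0) x := by
    rw [← pd_neg]
    exact pd_congr l (Filter.mem_of_superset hnhds fun y hy =>
      eq_neg_of_add_eq_zero_right (htracefree y hy))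
  have hdiv₀ := hdivfree x hx 0
  have hdiv₁ := hdivfree x hx 1
  rw [hpd_symm] at hdiv₀
  rw [hpd_trace] at hdiv₁
  intro i j k
  fin_cases i <;> fin_cases j <;> fin_cases k <;>
    simp only [Fin.zero_eta, Fin.mk_one, hpd_symm, hpd_trace] <;> linarith
end
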